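/- Let ζ_5 = e^{2πi/5} ∈ ℂ and let i ∈ ℂ be the imaginary unit. Then in ℂ[x,y]: Σ_{j=0}^{4} (ζ_5^j x² + i x y + ζ_5^{−j} y²)^{14} = 5^7 (x y)^{14}. Consequently the six binary quadratic forms ζ_5^j x² + i x y + ζ_5^{−j} y² (j = 0,…,4) and xy are nonzero, pairwise non-proportional, and their 14th powers are linearly dependent; hence Φ_2(14) ≤ 6. -/

import Mathlib

open MvPolynomial Finset

/-- The variable `x` in `ℂ[x,y]`. -/
noncomputable def Px : MvPolynomial (Fin 2) ℂ := MvPolynomial.X 0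

/-- The variable `y` in `ℂ[x,y]`. -/
noncomputable def Py : MvPolynomial (Fin 2) ℂ := MvPolynomial.X 1

/-- The primitive fifth root of unity `ζ_5 = e^{2πi/5}`. -/
noncomputable def zeta5 : ℂ := Complex.exp (2 * (Real.pi : ℂ) * Complex.I / 5)

/-- The six quadratic forms `ζ_5^j x² + i x y + ζ_5^{−j} y²` (for `j = 0,…,4`)
and `xy`. -/
noncomputable def icosForm : Fin 6 → MvPolynomial (Fin 2) ℂ := fun j =>
  if (j : ℕ) < 5 then
    C (zeta5 ^ (j : ℕ)) * Px ^ 2 + C Complex.I * Px * Py + C (zeta5⁻¹ ^ (j : ℕ)) * Py ^ 2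
  else Px * Py

/-- In `(u² + uv - v²)¹⁴` the only monomial whose degree in `u` is `4` modulo `5` is
`u¹⁴v¹⁴`. -/
lemma quadratic_pow_fourteen_decomposition (R : Type*) [CommRing R] :
    ∃ A₀ A₁ A₂ A₃ : R → R → R, ∀ u v : R,
      (u ^ 2 + u * v - v ^ 2) ^ 14 = -5 ^ 6 * (u * v) ^ 14 + A₀ (u ^ 5) v + u * A₁ (u ^ 5) v
        + u ^ 2 * A₂ (u ^ 5) v + u ^ 3 * A₃ (u ^ 5) v := by
  refine ⟨fun U v => v ^ 28 + 910 * U * v ^ 23 - 10010 * U ^ 2 * v ^ 18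
      + 6930 * U ^ 3 * v ^ 13 + 5005 * U ^ 4 * v ^ 8 + 182 * U ^ 5 * v ^ 3,
    fun U v => -14 * v ^ 27 - 1365 * U * v ^ 22 + 3640 * U ^ 2 * v ^ 17
      + 14105 * U ^ 3 * v ^ 12 + 1430 * U ^ 4 * v ^ 7 + 77 * U ^ 5 * v ^ 2,
    fun U v => 77 * v ^ 26 - 1430 * U * v ^ 21 + 14105 * U ^ 2 * v ^ 16
      - 3640 * U ^ 3 * v ^ 11 - 1365 * U ^ 4 * v ^ 6 + 14 * U ^ 5 * v,
    fun U v => -182 * v ^ 25 + 5005 * U * v ^ 20 - 6930 * U ^ 2 * v ^ 15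
      - 10010 * U ^ 3 * v ^ 10 - 910 * U ^ 4 * v ^ 5 + U ^ 5, fun u v => ?_⟩
  ring

lemma sum_quadratic_pow_fourteen {R : Type*} [CommRing R] {z : R}
    (hz : 1 + z + z ^ 2 + z ^ 3 + z ^ 4 = 0) (x v : R) :
    ∑ j ∈ Finset.range 5, (z ^ j * x ^ 2 + x * v - (z ^ 4) ^ j * v ^ 2) ^ 14
      = -5 ^ 7 * (x * v) ^ 14 := by
  obtain ⟨A₀, A₁, A₂, A₃, hA⟩ := quadratic_pow_fourteen_decomposition R
  have hz5 : z ^ 5 = 1 := by linear_combination (z - 1) * hz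
  have hterm (t : R) (ht : t ^ 5 = 1) : (t * x ^ 2 + x * v - t ^ 4 * v ^ 2) ^ 14
      = -5 ^ 6 * (x * v) ^ 14 + t * A₀ (x ^ 5) v + t ^ 2 * (x * A₁ (x ^ 5) v)
        + t ^ 3 * (x ^ 2 * A₂ (x ^ 5) v) + t ^ 4 * (x ^ 3 * A₃ (x ^ 5) v) := by
    have hu : (t * x) ^ 5 = x ^ 5 := by rw [mul_pow, ht, one_mul]
    have h15 : t ^ 15 = 1 := by rw [show 15 = 5 * 3 from rfl, pow_mul, ht, one_pow]
    have hfac : t * x ^ 2 + x * v - t ^ 4 * v ^ 2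
        = t ^ 4 * ((t * x) ^ 2 + (t * x) * v - v ^ 2) := by
      linear_combination (-(t * x ^ 2) - x * v) * ht
    have h56 : (t ^ 4) ^ 14 = t := by
      rw [← pow_mul, show 4 * 14 = 5 * 11 + 1 from rfl, pow_succ, pow_mul, ht, one_pow, one_mul]
    have h := hA (t * x) v
    rw [hu] at h
    rw [hfac, mul_pow, h56, h]
    linear_combination -5 ^ 6 * (x * v) ^ 14 * h15
  have hroot (j : ℕ) : (z ^ j) ^ 5 = 1 := by rw [pow_right_comm, hz5, one_pow]
  have hsum : ∑ j ∈ Finset.range 5, z ^ j = 0 := by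
    simpa [Finset.sum_range_succ] using hz
  have hsum2 : ∑ j ∈ Finset.range 5, (z ^ j) ^ 2 = 0 := by
    simp only [Finset.sum_range_succ, Finset.sum_range_zero]
    linear_combination hz + (z + z ^ 3) * hz5
  have hsum3 : ∑ j ∈ Finset.range 5, (z ^ j) ^ 3 = 0 := by
    simp only [Finset.sum_range_succ, Finset.sum_range_zero]
    linear_combination hz + (z + z ^ 4 + z ^ 7 + z ^ 2) * hz5
  have hsum4 : ∑ j ∈ Finset.range 5, (z ^ j) ^ 4 = 0 := by
    simp only [Finset.sum_range_succ, Finset.sum_range_zero]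
    linear_combination hz + (z ^ 3 + z ^ 7 + z ^ 2 + z ^ 11 + z ^ 6 + z) * hz5
  have hterms : ∀ j ∈ Finset.range 5, (z ^ j * x ^ 2 + x * v - (z ^ 4) ^ j * v ^ 2) ^ 14 = _ :=
    fun j _ => by rw [pow_right_comm z 4 j, hterm _ (hroot j)]
  rw [Finset.sum_congr rfl hterms]
  simp only [Finset.sum_add_distrib, ← Finset.sum_mul, hsum, hsum2, hsum3, hsum4,
    Finset.sum_const, Finset.card_range, nsmul_eq_mul]
  ring

lemma zeta5_isPrimitiveRoot : IsPrimitiveRoot zeta5 5 := by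
  simpa [zeta5] using Complex.isPrimitiveRoot_exp 5 (by norm_num)

lemma zeta5_ne_zero : zeta5 ≠ 0 := Complex.exp_ne_zero _

lemma zeta5_inv : zeta5⁻¹ = zeta5 ^ 4 :=
  inv_eq_of_mul_eq_one_right <| by
    rw [← pow_succ', zeta5_isPrimitiveRoot.pow_eq_one]

lemma sum_icosahedral_forms_pow_fourteen :
    ∑ j ∈ Finset.range 5,
        (C (zeta5 ^ j) * Px ^ 2 + C Complex.I * Px * Py + C (zeta5⁻¹ ^ j) * Py ^ 2) ^ 14
      = C ((5 : ℂ) ^ 7) * (Px * Py) ^ 14 := by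
  have hz : 1 + C zeta5 + C zeta5 ^ 2 + C zeta5 ^ 3 + C zeta5 ^ 4
      = (0 : MvPolynomial (Fin 2) ℂ) := by
    have h := zeta5_isPrimitiveRoot.geom_sum_eq_zero (by norm_num)
    simp only [Finset.sum_range_succ, Finset.sum_range_zero, zero_add, pow_zero, pow_one] at h
    simpa using congrArg (C : ℂ → MvPolynomial (Fin 2) ℂ) h
  have hI : (C Complex.I : MvPolynomial (Fin 2) ℂ) ^ 2 = -1 := by
    rw [← C_pow, Complex.I_sq, C_neg, C_1]
  have hI14 : (C Complex.I : MvPolynomial (Fin 2) ℂ) ^ 14 = -1 := by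
    rw [show 14 = 2 * 7 from rfl, pow_mul, hI]
    norm_num
  have h := sum_quadratic_pow_fourteen hz Px (C Complex.I * Py)
  rw [zeta5_inv]
  have hbase (j : ℕ) :
      C (zeta5 ^ j) * Px ^ 2 + C Complex.I * Px * Py + C ((zeta5 ^ 4) ^ j) * Py ^ 2
        = C zeta5 ^ j * Px ^ 2 + Px * (C Complex.I * Py)
          - (C zeta5 ^ 4) ^ j * (C Complex.I * Py) ^ 2 := by
    rw [mul_pow (C Complex.I), hI, C_pow, C_pow, C_pow]
    ring
  simp only [hbase]
  rw [h, mul_left_comm, mul_pow (C Complex.I), hI14, C_pow, map_ofNat, neg_one_mul, neg_mul_neg]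

lemma eval_icosForm_of_lt {j : Fin 6} (hj : (j : ℕ) < 5) (a b : ℂ) :
    eval ![a, b] (icosForm j)
      = zeta5 ^ (j : ℕ) * a ^ 2 + Complex.I * a * b + zeta5⁻¹ ^ (j : ℕ) * b ^ 2 := by
  simp [icosForm, hj, Px, Py]

lemma eval_icosForm_of_not_lt {j : Fin 6} (hj : ¬ (j : ℕ) < 5) (a b : ℂ) :
    eval ![a, b] (icosForm j) = a * b := by
  simp [icosForm, hj, Px, Py]

lemma icosForm_ne_smul {j k : Fin 6} (hjk : j ≠ k) (c : ℂ) : icosForm j ≠ c • icosForm k := by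
  intro h
  have hev (a b : ℂ) : eval ![a, b] (icosForm j) = c * eval ![a, b] (icosForm k) := by
    rw [h, smul_eval]
  have h₁ := hev 1 0
  have h₂ := hev 1 1
  have h₃ := hev 1 (-1)
  have hpow (n : ℕ) : zeta5 ^ n ≠ 0 := pow_ne_zero n zeta5_ne_zero
  by_cases hj : (j : ℕ) < 5 <;> by_cases hk : (k : ℕ) < 5
  · simp only [eval_icosForm_of_lt hj, eval_icosForm_of_lt hk] at h₁ h₂ h₃
    have hc : c = 1 := by
      have : (2 * Complex.I) * (c - 1) = 0 := by linear_combination h₃ - h₂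
      simpa [sub_eq_zero] using this
    have hp : zeta5 ^ (j : ℕ) = zeta5 ^ (k : ℕ) := by simpa [hc] using h₁
    exact hjk (Fin.ext (zeta5_isPrimitiveRoot.pow_inj hj hk hp))
  · simp [eval_icosForm_of_lt hj, eval_icosForm_of_not_lt hk, hpow] at h₁
  · simp only [eval_icosForm_of_not_lt hj, eval_icosForm_of_lt hk] at h₁ h₂
    have hc : c = 0 := by simpa [zeta5_ne_zero] using h₁
    simp [hc] at h₂
  · omega

lemma icosForm_ne_zero (j : Fin 6) : icosForm j ≠ 0 := by
  obtain ⟨k, hk⟩ := exists_ne j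
  simpa using icosForm_ne_smul hk.symm 0

/-- `Σ_{j=0}^{4} (ζ_5^j x² + i x y + ζ_5^{−j} y²)^{14} = 5^7 (xy)^{14}`;
consequently the six forms `ζ_5^j x² + ixy + ζ_5^{−j} y²` (`j = 0,…,4`) and `xy`
are nonzero, pairwise non-proportional, and their 14th powers admit a linear
dependence with all coefficients nonzero; hence `Φ_2(14) ≤ 6`. -/
theorem icosahedral_identity_deg14 :
    (∑ j ∈ Finset.range 5,
        (C (zeta5 ^ j) * Px ^ 2 + C Complex.I * Px * Py + C (zeta5⁻¹ ^ j) * Py ^ 2) ^ 14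
        = C ((5 : ℂ) ^ 7) * (Px * Py) ^ 14) ∧
    (∀ j, icosForm j ≠ 0) ∧
    (∀ j k, j ≠ k → ∀ c : ℂ, icosForm j ≠ c • icosForm k) ∧
    ∃ lam : Fin 6 → ℂ, (∀ j, lam j ≠ 0) ∧ ∑ j, lam j • icosForm j ^ 14 = 0 := by
  refine ⟨sum_icosahedral_forms_pow_fourteen, icosForm_ne_zero, fun _ _ => icosForm_ne_smul,
    fun j => if (j : ℕ) < 5 then 1 else -5 ^ 7, fun j => ?_, ?_⟩
  · dsimp only
    split_ifs <;> norm_num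
  · have h := sum_icosahedral_forms_pow_fourteen
    rw [Finset.sum_range] at h
    rw [Fin.sum_univ_castSucc]
    simp only [icosForm, Fin.val_castSucc, Fin.is_lt, Fin.val_last, lt_irrefl, if_true, if_false,
      one_smul]
    rw [h, smul_eq_C_mul, C_neg, neg_mul, add_neg_cancel]
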